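/- arXiv:1611.10282 — 3 statements merged into one kernel-verified Lean document; each statement's English description precedes it below -/
import Mathlib

section
/- Consider a 3×3 commutative diagram of abelian groups with exact rows and columns and splittings π₁, α₂, χ as described. Then the map I : B₁ ⊕ A₁ ⊕ B₃ ⊕ A₃ → E₂ defined by I(b₁, a₁, b₃, a₃) = e₁(π₁(b₁)) + e₁(i₁(a₁)) + χ(b₃) + i₂(α₂(a₃)) is an isomorphism of abelian groups (i.e. a bijective group homomorphism). (Lemma 3.1 of the paper.) -/
/-- If `f` is injective with range the kernel of `g`, and `g ∘ h` is bijective, then `E` is the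
direct sum of the images of `f` and `h`. -/
theorem AddMonoidHom.bijective_coprod_of_range_eq_ker {A B C E : Type*}
    [AddCommGroup A] [AddCommGroup B] [AddCommGroup C] [AddCommGroup E]
    {f : A →+ E} {g : E →+ B} {h : C →+ E} (hf : Function.Injective f)
    (hfg : f.range = g.ker) (hgh : Function.Bijective (g.comp h)) :
    Function.Bijective (f.coprod h) := by
  have hgf (a : A) : g (f a) = 0 := by
    rw [← AddMonoidHom.mem_ker, ← hfg]
    exact ⟨a, rfl⟩
  refine ⟨(injective_iff_map_eq_zero _).2 ?_, fun e => ?_⟩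
  · rintro ⟨a, c⟩ hac
    rw [AddMonoidHom.coprod_apply] at hac
    have hc : c = 0 := (injective_iff_map_eq_zero _).1 hgh.1 c (by
      simpa [hgf] using congrArg g hac)
    subst hc
    have ha : a = 0 := (injective_iff_map_eq_zero _).1 hf a (by simpa using hac)
    rw [ha, Prod.mk_zero_zero]
  · obtain ⟨c, hc⟩ := hgh.2 (g e)
    have hmem : e - h c ∈ f.range := by
      rw [hfg, AddMonoidHom.mem_ker, map_sub, ← hc, AddMonoidHom.comp_apply, sub_self]
    obtain ⟨a, ha⟩ := hmem
    exact ⟨(a, c), by rw [AddMonoidHom.coprod_apply, ha, sub_add_cancel]⟩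

/-- **Lemma 3.1.** Given a 3×3 commutative diagram of abelian groups with exact rows
and columns and splittings `π₁`, `α₂`, `χ`, the map
`I(b₁, a₁, b₃, a₃) = e₁(π₁ b₁) + e₁(i₁ a₁) + χ b₃ + i₂(α₂ a₃)`
is an isomorphism of abelian groups `B₁ ⊕ A₁ ⊕ B₃ ⊕ A₃ ≃ E₂`. -/
theorem splitting_lemma_3x3
    {A₁ A₂ A₃ E₁ E₂ E₃ B₁ B₂ B₃ : Type*}
    [AddCommGroup A₁] [AddCommGroup A₂] [AddCommGroup A₃]
    [AddCommGroup E₁] [AddCommGroup E₂] [AddCommGroup E₃]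
    [AddCommGroup B₁] [AddCommGroup B₂] [AddCommGroup B₃]
    (i₁ : A₁ →+ E₁) (i₂ : A₂ →+ E₂) (i₃ : A₃ →+ E₃)
    (p₁ : E₁ →+ B₁) (p₂ : E₂ →+ B₂) (p₃ : E₃ →+ B₃)
    (a₁ : A₁ →+ A₂) (a₂ : A₂ →+ A₃)
    (e₁ : E₁ →+ E₂) (e₂ : E₂ →+ E₃)
    (b₁ : B₁ →+ B₂) (b₂ : B₂ →+ B₃)
    -- exactness of the rows
    (hi₁ : Function.Injective i₁) (hp₁ : Function.Surjective p₁) (hrow₁ : i₁.range = p₁.ker)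
    (hi₂ : Function.Injective i₂) (hp₂ : Function.Surjective p₂) (hrow₂ : i₂.range = p₂.ker)
    (hi₃ : Function.Injective i₃) (hp₃ : Function.Surjective p₃) (hrow₃ : i₃.range = p₃.ker)
    -- exactness of the columns
    (ha₁ : Function.Injective a₁) (ha₂ : Function.Surjective a₂) (hcolA : a₁.range = a₂.ker)
    (he₁ : Function.Injective e₁) (he₂ : Function.Surjective e₂) (hcolE : e₁.range = e₂.ker)
    (hb₁ : Function.Injective b₁) (hb₂ : Function.Surjective b₂) (hcolB : b₁.range = b₂.ker)
    -- commutativity of the squares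
    (hsq₁ : ∀ x, e₁ (i₁ x) = i₂ (a₁ x)) (hsq₂ : ∀ x, p₂ (e₁ x) = b₁ (p₁ x))
    (hsq₃ : ∀ x, e₂ (i₂ x) = i₃ (a₂ x)) (hsq₄ : ∀ x, p₃ (e₂ x) = b₂ (p₂ x))
    -- splittings
    (π₁ : B₁ →+ E₁) (α₂ : A₃ →+ A₂) (χ : B₃ →+ E₂)
    (hπ₁ : ∀ b, p₁ (π₁ b) = b) (hα₂ : ∀ a, a₂ (α₂ a) = a) (hχ : ∀ b, b₂ (p₂ (χ b)) = b) :
    ∃ I : (B₁ × A₁ × B₃ × A₃) ≃+ E₂,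
      ∀ (x₁ : B₁) (x₂ : A₁) (x₃ : B₃) (x₄ : A₃),
        I (x₁, x₂, x₃, x₄) = e₁ (π₁ x₁) + e₁ (i₁ x₂) + χ x₃ + i₂ (α₂ x₄) := by
  have hE₁ : Function.Bijective (i₁.coprod π₁) := by
    refine AddMonoidHom.bijective_coprod_of_range_eq_ker hi₁ hrow₁ ?_
    rw [show p₁.comp π₁ = AddMonoidHom.id B₁ from AddMonoidHom.ext hπ₁]
    exact Function.bijective_id
  have hE₃ : Function.Bijective (i₃.coprod (e₂.comp χ)) := by
    refine AddMonoidHom.bijective_coprod_of_range_eq_ker hi₃ hrow₃ ?_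
    rw [show p₃.comp (e₂.comp χ) = AddMonoidHom.id B₃ from
      AddMonoidHom.ext fun b => (hsq₄ _).trans (hχ b)]
    exact Function.bijective_id
  have hE₂ : Function.Bijective
      ((e₁.comp (i₁.coprod π₁)).coprod ((i₂.comp α₂).coprod χ)) := by
    refine AddMonoidHom.bijective_coprod_of_range_eq_ker (g := e₂) (he₁.comp hE₁.1) ?_ ?_
    · rw [AddMonoidHom.range_comp, AddMonoidHom.range_eq_top.2 hE₁.2,
        ← AddMonoidHom.range_eq_map, hcolE]
    · convert hE₃ using 2
      ext
      simp [hsq₃, hα₂]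
  let reorder : (B₁ × A₁ × B₃ × A₃) ≃+ (A₁ × B₁) × (A₃ × B₃) :=
    AddEquiv.prodAssoc.symm.trans (AddEquiv.prodCongr AddEquiv.prodComm AddEquiv.prodComm)
  refine ⟨reorder.trans (AddEquiv.ofBijective _ hE₂), fun x₁ x₂ x₃ x₄ => ?_⟩
  change e₁ (i₁ x₂ + π₁ x₁) + (i₂ (α₂ x₄) + χ x₃) = _
  rw [map_add]
  abel
end

section
/- Consider a 3×3 commutative diagram of abelian groups with exact rows and columns and splittings π₁, α₂, χ as described. Let ι₁ : E₁ → A₁ be the unique homomorphism with π₁∘p₁ + i₁∘ι₁ = id_{E₁}; set π₃ := e₂∘χ and let ι₃ : E₃ → A₃ be the unique homomorphism with π₃∘p₃ + i₃∘ι₃ = id_{E₃}; set ε₂ := χ∘p₃ + i₂∘α₂∘ι₃ and let ε₁ : E₂ → E₁ be the unique homomorphism with ε₂∘e₂ + e₁∘ε₁ = id_{E₂}. Then the homomorphism J : E₂ → B₁ ⊕ A₁ ⊕ B₃ ⊕ A₃, J(x) = (p₁(ε₁(x)), ι₁(ε₁(x)), p₃(e₂(x)), ι₃(e₂(x))), is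 a two-sided inverse of the homomorphism I : B₁ ⊕ A₁ ⊕ B₃ ⊕ A₃ → E₂, I(b₁, a₁, b₃, a₃) = e₁(π₁(b₁)) + e₁(i₁(a₁)) + χ(b₃) + i₂(α₂(a₃)); that is, I∘J = id_{E₂} and J∘I = id. -/
/-- In the 3×3 diagram with exact rows and columns and splittings `π₁`, `α₂`, `χ`:
with `ι₁`, `ι₃`, `ε₁` the unique complementary homomorphisms
(`π₁ ∘ p₁ + i₁ ∘ ι₁ = id`, `π₃ ∘ p₃ + i₃ ∘ ι₃ = id` for `π₃ = e₂ ∘ χ`, and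
`ε₂ ∘ e₂ + e₁ ∘ ε₁ = id` for `ε₂ = χ ∘ p₃ + i₂ ∘ α₂ ∘ ι₃`), the homomorphism
`J x = (p₁(ε₁ x), ι₁(ε₁ x), p₃(e₂ x), ι₃(e₂ x))` is a two-sided inverse of
`I(b₁, a₁, b₃, a₃) = e₁(π₁ b₁) + e₁(i₁ a₁) + χ b₃ + i₂(α₂ a₃)`. -/
theorem J_is_two_sided_inverse_of_I
    {A₁ A₂ A₃ E₁ E₂ E₃ B₁ B₂ B₃ : Type*}
    [AddCommGroup A₁] [AddCommGroup A₂] [AddCommGroup A₃]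
    [AddCommGroup E₁] [AddCommGroup E₂] [AddCommGroup E₃]
    [AddCommGroup B₁] [AddCommGroup B₂] [AddCommGroup B₃]
    (i₁ : A₁ →+ E₁) (i₂ : A₂ →+ E₂) (i₃ : A₃ →+ E₃)
    (p₁ : E₁ →+ B₁) (p₂ : E₂ →+ B₂) (p₃ : E₃ →+ B₃)
    (a₁ : A₁ →+ A₂) (a₂ : A₂ →+ A₃)
    (e₁ : E₁ →+ E₂) (e₂ : E₂ →+ E₃)
    (b₁ : B₁ →+ B₂) (b₂ : B₂ →+ B₃)
    -- exactness of the rows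
    (hi₁ : Function.Injective i₁) (hp₁ : Function.Surjective p₁) (hrow₁ : i₁.range = p₁.ker)
    (hi₂ : Function.Injective i₂) (hp₂ : Function.Surjective p₂) (hrow₂ : i₂.range = p₂.ker)
    (hi₃ : Function.Injective i₃) (hp₃ : Function.Surjective p₃) (hrow₃ : i₃.range = p₃.ker)
    -- exactness of the columns
    (ha₁ : Function.Injective a₁) (ha₂ : Function.Surjective a₂) (hcolA : a₁.range = a₂.ker)
    (he₁ : Function.Injective e₁) (he₂ : Function.Surjective e₂) (hcolE : e₁.range = e₂.ker)
    (hb₁ : Function.Injective b₁) (hb₂ : Function.Surjective b₂) (hcolB : b₁.range = b₂.ker)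
    -- commutativity of the squares
    (hsq₁ : ∀ x, e₁ (i₁ x) = i₂ (a₁ x)) (hsq₂ : ∀ x, p₂ (e₁ x) = b₁ (p₁ x))
    (hsq₃ : ∀ x, e₂ (i₂ x) = i₃ (a₂ x)) (hsq₄ : ∀ x, p₃ (e₂ x) = b₂ (p₂ x))
    -- splittings
    (π₁ : B₁ →+ E₁) (α₂ : A₃ →+ A₂) (χ : B₃ →+ E₂)
    (hπ₁ : ∀ b, p₁ (π₁ b) = b) (hα₂ : ∀ a, a₂ (α₂ a) = a) (hχ : ∀ b, b₂ (p₂ (χ b)) = b)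
    (ι₁ : E₁ →+ A₁) (hι₁ : ∀ x : E₁, π₁ (p₁ x) + i₁ (ι₁ x) = x)
    (ι₃ : E₃ →+ A₃) (hι₃ : ∀ x : E₃, e₂ (χ (p₃ x)) + i₃ (ι₃ x) = x)
    (ε₁ : E₂ →+ E₁)
    (hε₁ : ∀ x : E₂, (χ (p₃ (e₂ x)) + i₂ (α₂ (ι₃ (e₂ x)))) + e₁ (ε₁ x) = x) :
    (∀ x : E₂,
      e₁ (π₁ (p₁ (ε₁ x))) + e₁ (i₁ (ι₁ (ε₁ x))) + χ (p₃ (e₂ x)) + i₂ (α₂ (ι₃ (e₂ x))) = x) ∧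
    (∀ (y₁ : B₁) (y₂ : A₁) (y₃ : B₃) (y₄ : A₃),
      (p₁ (ε₁ (e₁ (π₁ y₁) + e₁ (i₁ y₂) + χ y₃ + i₂ (α₂ y₄))),
       ι₁ (ε₁ (e₁ (π₁ y₁) + e₁ (i₁ y₂) + χ y₃ + i₂ (α₂ y₄))),
       p₃ (e₂ (e₁ (π₁ y₁) + e₁ (i₁ y₂) + χ y₃ + i₂ (α₂ y₄))),
       ι₃ (e₂ (e₁ (π₁ y₁) + e₁ (i₁ y₂) + χ y₃ + i₂ (α₂ y₄))))
        = (y₁, y₂, y₃, y₄)) := by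
  have hpi₁ : ∀ a, p₁ (i₁ a) = 0 := fun a => hrow₁.le ⟨a, rfl⟩
  have hpi₃ : ∀ a, p₃ (i₃ a) = 0 := fun a => hrow₃.le ⟨a, rfl⟩
  have hee : ∀ x, e₂ (e₁ x) = 0 := fun x => hcolE.le ⟨x, rfl⟩
  refine ⟨fun x => ?_, fun y₁ y₂ y₃ y₄ => ?_⟩
  · rw [← map_add e₁, hι₁, add_assoc, add_comm, hε₁]
  · set x := e₁ (π₁ y₁) + e₁ (i₁ y₂) + χ y₃ + i₂ (α₂ y₄) with hx
    have he₂x : e₂ x = e₂ (χ y₃) + i₃ y₄ := by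
      simp [hx, hee, hsq₃, hα₂]
    have hp₃x : p₃ (e₂ x) = y₃ := by
      rw [he₂x, map_add, hpi₃, hsq₄, hχ, add_zero]
    have hι₃x : ι₃ (e₂ x) = y₄ := by
      have h := hι₃ (e₂ x)
      rw [hp₃x] at h
      exact hi₃ (add_left_cancel (h.trans he₂x))
    have hε₁x : ε₁ x = π₁ y₁ + i₁ y₂ := by
      have h := hε₁ x
      rw [hp₃x, hι₃x] at h
      apply he₁
      apply add_left_cancel (a := χ y₃ + i₂ (α₂ y₄))
      rw [h, hx, map_add]
      abel
    have hp₁x : p₁ (ε₁ x) = y₁ := by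
      rw [hε₁x, map_add, hpi₁, hπ₁, add_zero]
    have hι₁x : ι₁ (ε₁ x) = y₂ := by
      have h := hι₁ (ε₁ x)
      rw [hp₁x] at h
      exact hi₁ (add_left_cancel (h.trans hε₁x))
    rw [hp₁x, hι₁x, hp₃x, hι₃x]
end

section
/- For every finite index set I and families α : I → ℂ and (u, z) : I → U × Z, the sum S := Σ over pairs (i,j) ∈ I × I with z_i = z_j of conj(α_i)·α_j·e(σ(−(u_i, z_i), (u_j, z_j))) satisfies S = Σ over the (finitely many) values w ∈ Z attained by the family (z_i) of |Σ over i ∈ I with z_i = w of α_i·e(σ((u_i, 0), (0, z_i)))|². In particular, S is a nonnegative real number. (This is the positivity computation establishing that ω_free is a state, Proposition 4.5.) -/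
/-- The standard character `e : 𝕋 = ℝ/ℤ → ℂ`, `e(t) = exp(2πit)`. -/
noncomputable def stdChar (t : AddCircle (1 : ℝ)) : ℂ := AddCircle.toCircle t

theorem stdChar_add (s t : AddCircle (1 : ℝ)) : stdChar (s + t) = stdChar s * stdChar t := by
  simp [stdChar, AddCircle.toCircle_add]

theorem stdChar_neg (t : AddCircle (1 : ℝ)) :
    stdChar (-t) = (starRingEnd ℂ) (stdChar t) := by
  rw [stdChar, AddCircle.toCircle_neg, Circle.coe_inv_eq_conj, stdChar]

/-- On a common fibre over `Z`, a biadditive antisymmetric form with isotropic factors is a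
coboundary. -/
theorem biadditive_neg_pair_eq_sub {U Z A : Type*} [AddCommGroup U] [AddCommGroup Z]
    [AddCommGroup A] (σ : U × Z → U × Z → A)
    (hadd_left : ∀ x x' y, σ (x + x') y = σ x y + σ x' y)
    (hadd_right : ∀ x y y', σ x (y + y') = σ x y + σ x y')
    (hanti : ∀ x y, σ x y = - σ y x)
    (hisoU : ∀ u u' : U, σ (u, 0) (u', 0) = 0)
    (hisoZ : ∀ z z' : Z, σ (0, z) (0, z') = 0) (u u' : U) (z : Z) :
    σ (-(u, z)) (u', z) = σ (u', 0) (0, z) - σ (u, 0) (0, z) := by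
  have hneg (x y : U × Z) : σ (-x) y = -σ x y :=
    map_neg (AddMonoidHom.mk' (fun x => σ x y) fun a b => hadd_left a b y) x
  have hsplit (v : U) : (v, z) = (v, 0) + (0, z) := by simp
  rw [hneg, hsplit u, hsplit u', hadd_left, hadd_right, hadd_right, hisoU, hisoZ,
    hanti (0, z) (u', 0)]
  abel

/-- A Hermitian square restricted to pairs in a common fibre of `z` is a sum of squared norms. -/
theorem sum_sum_ite_conj_mul_eq_sum_norm_sq {I Z : Type*} [Fintype I] [DecidableEq Z]
    (z : I → Z) (b : I → ℂ) :
    (∑ i : I, ∑ j : I, if z i = z j then (starRingEnd ℂ) (b i) * b j else 0)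
      = ((∑ w ∈ Finset.univ.image z,
          ‖∑ i ∈ Finset.univ.filter (fun i => z i = w), b i‖ ^ 2 : ℝ) : ℂ) := by
  rw [← Finset.sum_fiberwise_of_maps_to (s := Finset.univ) (t := Finset.univ.image z) (g := z)
    fun i _ => Finset.mem_image_of_mem z (Finset.mem_univ i), Complex.ofReal_sum]
  refine Finset.sum_congr rfl fun w _ => ?_
  rw [Complex.ofReal_pow, ← Complex.conj_mul', map_sum, Finset.sum_mul_sum]
  refine Finset.sum_congr rfl fun i hi => ?_
  rw [Finset.sum_filter]
  refine Finset.sum_congr rfl fun j _ => ?_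
  simp only [(Finset.mem_filter.mp hi).2, eq_comm (a := w)]

/-- Positivity computation for the state `ω_free` on the Weyl algebra of the
torsion-free topological sector (Proposition 4.5): the sum
`S = Σ_{z i = z j} conj(α i) α j e(σ(−(u i, z i), (u j, z j)))` equals the sum over the
values `w` attained by `z` of `|Σ_{z i = w} α i e(σ((u i,0),(0,z i)))|²`; in particular
`S` is a nonnegative real number. -/
theorem omega_free_positivity
    {U Z : Type*} [AddCommGroup U] [AddCommGroup Z] [DecidableEq Z]
    (σ : U × Z → U × Z → AddCircle (1 : ℝ))
    (hadd_left : ∀ x x' y, σ (x + x') y = σ x y + σ x' y)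
    (hadd_right : ∀ x y y', σ x (y + y') = σ x y + σ x y')
    (hanti : ∀ x y, σ x y = - σ y x)
    (hisoU : ∀ u u' : U, σ (u, 0) (u', 0) = 0)
    (hisoZ : ∀ z z' : Z, σ (0, z) (0, z') = 0)
    {I : Type*} [Fintype I] (α : I → ℂ) (u : I → U) (z : I → Z) :
    (∑ i : I, ∑ j : I, if z i = z j then
        (starRingEnd ℂ) (α i) * α j * stdChar (σ (-(u i, z i)) (u j, z j)) else 0)
      = (((∑ w ∈ Finset.univ.image z,
            ‖∑ i ∈ Finset.univ.filter (fun i => z i = w),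
                α i * stdChar (σ (u i, 0) (0, z i))‖ ^ 2) : ℝ) : ℂ)
    ∧ ∃ r : ℝ, 0 ≤ r ∧
        (∑ i : I, ∑ j : I, if z i = z j then
          (starRingEnd ℂ) (α i) * α j * stdChar (σ (-(u i, z i)) (u j, z j)) else 0) = (r : ℂ) := by
  have key : (∑ i : I, ∑ j : I, if z i = z j then
        (starRingEnd ℂ) (α i) * α j * stdChar (σ (-(u i, z i)) (u j, z j)) else 0)
      = (((∑ w ∈ Finset.univ.image z,
            ‖∑ i ∈ Finset.univ.filter (fun i => z i = w),
                α i * stdChar (σ (u i, 0) (0, z i))‖ ^ 2) : ℝ) : ℂ) := by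
    rw [← sum_sum_ite_conj_mul_eq_sum_norm_sq]
    refine Finset.sum_congr rfl fun i _ => Finset.sum_congr rfl fun j _ => ?_
    split_ifs with h
    · rw [← h, biadditive_neg_pair_eq_sub σ hadd_left hadd_right hanti hisoU hisoZ,
        sub_eq_add_neg, stdChar_add, stdChar_neg, map_mul]
      ring
    · rfl
  exact ⟨key, _, Finset.sum_nonneg fun _ _ => sq_nonneg _, key⟩
end
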